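/- For f ∈ bmo(ℝⁿ), the following are equivalent: (i) there exist functions f_k ∈ bmo(ℝⁿ) with compact support such that ‖f − f_k‖_{bmo(ℝⁿ)} → 0; (ii) f vanishes at infinity, i.e., lim_{R→∞} ‖f‖_{bmo_1(ℝⁿ ∖ closure(B(0,R)))} = 0; (iii) lim_{β→∞} γ(f,β) = 0, where γ(f,β) := sup{ ⨍_Q |f − f_Q| : dist(Q,0) > β, ℓ(Q) < 1 } + sup{ |f|_Q : dist(Q,0) > β, ℓ(Q) = 1 }; (iv) lim_{β→∞} ( sup{ ⨍_Q |f − f_Q| : dist(Q,0) > β, ℓ(Q) < 1 } + sup{ |f|_Q · ℓ(Q) : dist(Q,0) > β, ℓ(Q) ≤ 1 } ) = 0. -/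

import Mathlib

open MeasureTheory Metric Filter Topology

noncomputable section

/-- A closed axis-parallel cube in ℝⁿ: a closed ball in the sup norm with
positive radius (`half` = half the sidelength). -/
structure Cube (n : ℕ) where
  center : Fin n → ℝ
  half : ℝ
  half_pos : 0 < half

namespace Cube

variable {n : ℕ}

/-- The underlying set of a cube. -/
def toSet (Q : Cube n) : Set (Fin n → ℝ) := Metric.closedBall Q.center Q.half

/-- The sidelength ℓ(Q). -/
def side (Q : Cube n) : ℝ := 2 * Q.half

/-- The mean f_Q of f over Q. -/
def avg (Q : Cube n) (f : (Fin n → ℝ) → ℝ) : ℝ := ⨍ x in Q.toSet, f x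

/-- Mean oscillation of f over Q. -/
def osc (Q : Cube n) (f : (Fin n → ℝ) → ℝ) : ℝ := ⨍ x in Q.toSet, |f x - Q.avg f|

/-- The mean |f|_Q of |f| over Q. -/
def avgAbs (Q : Cube n) (f : (Fin n → ℝ) → ℝ) : ℝ := ⨍ x in Q.toSet, |f x|

/-- Distance from the cube to the origin. -/
def distToOrigin (Q : Cube n) : ℝ := Metric.infDist (0 : Fin n → ℝ) Q.toSet

/-- The cube 2Q, concentric with Q and of twice the sidelength. -/
def double (Q : Cube n) : Cube n := ⟨Q.center, 2 * Q.half, mul_pos two_pos Q.half_pos⟩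

end Cube

variable {n : ℕ}

/-- The modulus of mean oscillation ω_U(f,t): the supremum of the mean oscillation
of f over cubes Q ⊆ U of sidelength < t. -/
def omegaOn (U : Set (Fin n → ℝ)) (f : (Fin n → ℝ) → ℝ) (t : ℝ) : ℝ :=
  sSup {r | ∃ Q : Cube n, Q.toSet ⊆ U ∧ Q.side < t ∧ r = Q.osc f}

/-- sup{ |f|_Q : Q ⊆ U, ℓ(Q) ≥ lam }. -/
def bigAvgSup (U : Set (Fin n → ℝ)) (lam : ℝ) (f : (Fin n → ℝ) → ℝ) : ℝ :=
  sSup {r | ∃ Q : Cube n, Q.toSet ⊆ U ∧ lam ≤ Q.side ∧ r = Q.avgAbs f}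

/-- The nonhomogeneous norm ‖f‖_{bmo_lam(U)}. -/
def bmoNorm (U : Set (Fin n → ℝ)) (lam : ℝ) (f : (Fin n → ℝ) → ℝ) : ℝ :=
  omegaOn U f lam + bigAvgSup U lam f

/-- Membership in bmo_lam(U): integrable on every cube in U and finite norm. -/
def MemBmo (U : Set (Fin n → ℝ)) (lam : ℝ) (f : (Fin n → ℝ) → ℝ) : Prop :=
  (∀ Q : Cube n, Q.toSet ⊆ U → IntegrableOn f Q.toSet) ∧
  BddAbove {r | ∃ Q : Cube n, Q.toSet ⊆ U ∧ Q.side < lam ∧ r = Q.osc f} ∧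
  BddAbove {r | ∃ Q : Cube n, Q.toSet ⊆ U ∧ lam ≤ Q.side ∧ r = Q.avgAbs f}

/-- Sarason's vanishing mean oscillation condition: ω_U(f,t) → 0 as t → 0⁺. -/
def VanishSmallOsc (U : Set (Fin n → ℝ)) (f : (Fin n → ℝ) → ℝ) : Prop :=
  Tendsto (fun t => omegaOn U f t) (nhdsWithin 0 (Set.Ioi 0)) (nhds 0)

/-- f is bounded on U. -/
def BoundedOn (U : Set (Fin n → ℝ)) (f : (Fin n → ℝ) → ℝ) : Prop :=
  ∃ M : ℝ, ∀ x ∈ U, |f x| ≤ M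

/-- f is Lipschitz on U. -/
def LipschitzOn (U : Set (Fin n → ℝ)) (f : (Fin n → ℝ) → ℝ) : Prop :=
  ∃ K : NNReal, LipschitzOnWith K f U

/-- dist(supp f, ∂U) > 0. -/
def SuppAway (U : Set (Fin n → ℝ)) (f : (Fin n → ℝ) → ℝ) : Prop :=
  ∃ d > 0, ∀ x ∈ Function.support f, ∀ y ∈ frontier U, d ≤ dist x y

/-- The nonhomogeneous Lipschitz norm ‖f‖_{Lip_b(U)} = ‖f‖_∞ + Lipschitz seminorm. -/
def lipbNorm (U : Set (Fin n → ℝ)) (f : (Fin n → ℝ) → ℝ) : ℝ :=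
  sSup {r | ∃ x ∈ U, r = |f x|} +
  sSup {r | ∃ x ∈ U, ∃ y ∈ U, x ≠ y ∧ r = |f x - f y| / dist x y}

/-- U is a domain: a nonempty open connected subset of ℝⁿ. -/
def IsRealDomain (U : Set (Fin n → ℝ)) : Prop := IsOpen U ∧ IsConnected U

/-- U is an (ε,δ)-domain. -/
def IsEpsDeltaDomain (U : Set (Fin n → ℝ)) (ε δ : ℝ) : Prop :=
  ∀ x ∈ U, ∀ y ∈ U, dist x y < δ →
    ∃ γ : ℝ → (Fin n → ℝ), ContinuousOn γ (Set.Icc 0 1) ∧ γ 0 = x ∧ γ 1 = y ∧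
      (∀ t ∈ Set.Icc (0:ℝ) 1, γ t ∈ U) ∧
      eVariationOn γ (Set.Icc 0 1) ≤ ENNReal.ofReal (ε⁻¹ * dist x y) ∧
      ∀ t ∈ Set.Icc (0:ℝ) 1,
        ε * (dist (γ t) x * dist (γ t) y) / dist x y ≤ Metric.infDist (γ t) (frontier U)

/-- The natural scale λ_{ε,δ} for an (ε,δ)-domain. -/
def lamED (n : ℕ) (ε δ : ℝ) : ℝ := ε ^ 2 * δ / (320 * n * (1 + Real.sqrt n * ε))

/-- d_Ω(x) = dist(x,∂Ω). -/
def distBd (U : Set (Fin n → ℝ)) (x : Fin n → ℝ) : ℝ := Metric.infDist x (frontier U)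

/-- Ω̊_t = {x ∈ Ω : d_Ω(x) ≥ t}. -/
def innerPart (U : Set (Fin n → ℝ)) (t : ℝ) : Set (Fin n → ℝ) :=
  {x ∈ U | t ≤ distBd U x}

/-- f vanishes at infinity in the bmo_lam(U) sense. -/
def VanishAtInfinity (U : Set (Fin n → ℝ)) (lam : ℝ) (f : (Fin n → ℝ) → ℝ) : Prop :=
  Tendsto (fun R => bmoNorm (U \ Metric.closedBall 0 R) lam f) atTop (nhds 0)

/-- f vanishes at the boundary in the bmo_lam(U) sense. -/
def VanishAtBoundary (U : Set (Fin n → ℝ)) (lam : ℝ) (f : (Fin n → ℝ) → ℝ) : Prop :=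
  Tendsto (fun t => bmoNorm (U \ innerPart U t) lam f) (nhdsWithin 0 (Set.Ioi 0)) (nhds 0)

/-- f is in the bmo_lam(U)-closure of the continuous functions with compact support in U. -/
def InCmoClosure (U : Set (Fin n → ℝ)) (lam : ℝ) (f : (Fin n → ℝ) → ℝ) : Prop :=
  ∃ g : ℕ → (Fin n → ℝ) → ℝ,
    (∀ j, Continuous (g j) ∧ HasCompactSupport (g j) ∧ tsupport (g j) ⊆ U) ∧
    Tendsto (fun j => bmoNorm U lam (f - g j)) atTop (nhds 0)

/-- The homogeneous BMO(ℝⁿ) seminorm: sup of mean oscillation over all cubes. -/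
def bmoHNorm (f : (Fin n → ℝ) → ℝ) : ℝ := sSup {r | ∃ Q : Cube n, r = Q.osc f}
theorem tendsto_sSup_add_sSup_iff {ι : Type*} {l : Filter ι} {A B : ι → Set ℝ}
    (hA0 : ∀ i, ∀ r ∈ A i, 0 ≤ r) (hB0 : ∀ i, ∀ r ∈ B i, 0 ≤ r)
    (hA : ∀ i, BddAbove (A i)) (hB : ∀ i, BddAbove (B i)) :
    Tendsto (fun i => sSup (A i) + sSup (B i)) l (nhds 0) ↔
      ∀ ε > 0, ∀ᶠ i in l, (∀ r ∈ A i, r ≤ ε) ∧ ∀ r ∈ B i, r ≤ ε := by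
  have nA i : 0 ≤ sSup (A i) := Real.sSup_nonneg (hA0 i)
  have nB i : 0 ≤ sSup (B i) := Real.sSup_nonneg (hB0 i)
  rw [Metric.tendsto_nhds]
  constructor
  · intro h ε hε
    filter_upwards [h ε hε] with i hi
    rw [Real.dist_eq, sub_zero, abs_of_nonneg (add_nonneg (nA i) (nB i))] at hi
    exact ⟨fun r hr => by linarith [le_csSup (hA i) hr, nB i],
      fun r hr => by linarith [le_csSup (hB i) hr, nA i]⟩
  · intro h ε hε
    filter_upwards [h (ε / 3) (by positivity)] with i hi
    rw [Real.dist_eq, sub_zero, abs_of_nonneg (add_nonneg (nA i) (nB i))]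
    linarith [Real.sSup_le hi.1 (by positivity), Real.sSup_le hi.2 (by positivity)]

namespace Cube

theorem side_pos (Q : Cube n) : 0 < Q.side := mul_pos two_pos Q.half_pos

theorem volume_real_toSet (Q : Cube n) : volume.real Q.toSet = Q.side ^ n := by
  have h := Q.half_pos
  rw [Measure.real, toSet, Real.volume_pi_closedBall _ h.le, Fintype.card_fin,
    ENNReal.toReal_ofReal (by positivity), side]

theorem avg_eq (Q : Cube n) (f : (Fin n → ℝ) → ℝ) :
    Q.avg f = (Q.side ^ n)⁻¹ * ∫ x in Q.toSet, f x := by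
  rw [avg, setAverage_eq, volume_real_toSet, smul_eq_mul]

theorem volume_toSet_ne_top (Q : Cube n) : volume Q.toSet ≠ ⊤ :=
  (isCompact_closedBall _ _).measure_ne_top

theorem measurableSet_toSet (Q : Cube n) : MeasurableSet Q.toSet :=
  isClosed_closedBall.measurableSet

theorem integrableOn_const (Q : Cube n) (c : ℝ) : IntegrableOn (fun _ => c) Q.toSet :=
  MeasureTheory.integrableOn_const Q.volume_toSet_ne_top

theorem avg_const (Q : Cube n) (c : ℝ) : Q.avg (fun _ => c) = c := by
  have := Q.side_pos
  rw [avg_eq, setIntegral_const, volume_real_toSet, smul_eq_mul]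
  field_simp

theorem avg_add (Q : Cube n) {f g : (Fin n → ℝ) → ℝ} (hf : IntegrableOn f Q.toSet)
    (hg : IntegrableOn g Q.toSet) : Q.avg (fun x => f x + g x) = Q.avg f + Q.avg g := by
  rw [avg_eq, avg_eq, avg_eq, integral_add hf hg, mul_add]

theorem avg_sub (Q : Cube n) {f g : (Fin n → ℝ) → ℝ} (hf : IntegrableOn f Q.toSet)
    (hg : IntegrableOn g Q.toSet) : Q.avg (fun x => f x - g x) = Q.avg f - Q.avg g := by
  rw [avg_eq, avg_eq, avg_eq, integral_sub hf hg, mul_sub]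

theorem avg_const_mul (Q : Cube n) (f : (Fin n → ℝ) → ℝ) (c : ℝ) :
    Q.avg (fun x => c * f x) = c * Q.avg f := by
  rw [avg_eq, avg_eq, integral_const_mul]; ring

theorem avg_mono (Q : Cube n) {f g : (Fin n → ℝ) → ℝ} (hf : IntegrableOn f Q.toSet)
    (hg : IntegrableOn g Q.toSet) (h : ∀ x ∈ Q.toSet, f x ≤ g x) : Q.avg f ≤ Q.avg g := by
  have := Q.side_pos
  rw [avg_eq, avg_eq]
  exact mul_le_mul_of_nonneg_left (setIntegral_mono_on hf hg Q.measurableSet_toSet h)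
    (by positivity)

theorem avg_congr (Q : Cube n) {f g : (Fin n → ℝ) → ℝ} (h : ∀ x ∈ Q.toSet, f x = g x) :
    Q.avg f = Q.avg g := by
  rw [avg_eq, avg_eq, setIntegral_congr_fun Q.measurableSet_toSet h]

theorem avg_nonneg (Q : Cube n) {f : (Fin n → ℝ) → ℝ} (h : ∀ x, 0 ≤ f x) : 0 ≤ Q.avg f := by
  have := Q.side_pos
  rw [avg_eq]
  exact mul_nonneg (by positivity) (integral_nonneg h)

theorem abs_avg_le (Q : Cube n) (f : (Fin n → ℝ) → ℝ) : |Q.avg f| ≤ Q.avgAbs f := by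
  have := Q.side_pos
  change _ ≤ Q.avg (fun x => |f x|)
  rw [avg_eq, avg_eq, abs_mul, abs_of_pos (by positivity : 0 < (Q.side ^ n)⁻¹)]
  exact mul_le_mul_of_nonneg_left abs_integral_le_integral_abs (by positivity)

theorem avgAbs_nonneg (Q : Cube n) (f : (Fin n → ℝ) → ℝ) : 0 ≤ Q.avgAbs f :=
  Q.avg_nonneg fun _ => abs_nonneg _

theorem osc_nonneg (Q : Cube n) (f : (Fin n → ℝ) → ℝ) : 0 ≤ Q.osc f :=
  Q.avg_nonneg fun _ => abs_nonneg _

theorem avgAbs_congr (Q : Cube n) {f g : (Fin n → ℝ) → ℝ} (h : ∀ x ∈ Q.toSet, f x = g x) :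
    Q.avgAbs f = Q.avgAbs g :=
  Q.avg_congr fun x hx => by rw [h x hx]

theorem osc_congr (Q : Cube n) {f g : (Fin n → ℝ) → ℝ} (h : ∀ x ∈ Q.toSet, f x = g x) :
    Q.osc f = Q.osc g :=
  Q.avg_congr fun x hx => by rw [h x hx, Q.avg_congr h]

theorem avgAbs_mono (Q : Cube n) {f g : (Fin n → ℝ) → ℝ} (hf : IntegrableOn f Q.toSet)
    (hg : IntegrableOn g Q.toSet) (h : ∀ x ∈ Q.toSet, |f x| ≤ |g x|) :
    Q.avgAbs f ≤ Q.avgAbs g :=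
  Q.avg_mono hf.abs hg.abs h

theorem avgAbs_zero (Q : Cube n) : Q.avgAbs (fun _ => 0) = 0 := by
  change Q.avg (fun _ => |(0 : ℝ)|) = 0
  rw [avg_const, abs_zero]

theorem osc_zero (Q : Cube n) : Q.osc (fun _ => 0) = 0 := by
  change Q.avg (fun _ => |(0 : ℝ) - Q.avg fun _ => 0|) = 0
  rw [avg_const, avg_const, sub_zero, abs_zero]

/-- Up to a factor two, the mean minimizes the mean distance to constants. -/
theorem osc_le_two_mul (Q : Cube n) {f : (Fin n → ℝ) → ℝ} (hf : IntegrableOn f Q.toSet) (c : ℝ) :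
    Q.osc f ≤ 2 * Q.avgAbs (fun x => f x - c) := by
  have hc := Q.integrableOn_const c
  have hfc : IntegrableOn (fun x => |f x - c|) Q.toSet := (hf.sub hc).abs
  have h1 : |Q.avg f - c| ≤ Q.avgAbs (fun x => f x - c) := by
    have := Q.abs_avg_le (fun x => f x - c)
    rwa [Q.avg_sub hf hc, Q.avg_const] at this
  calc Q.osc f ≤ Q.avg (fun x => |f x - c| + |Q.avg f - c|) := by
        refine Q.avg_mono (hf.sub (Q.integrableOn_const _)).abs
          (hfc.add (Q.integrableOn_const _)) fun x _ => ?_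
        rw [abs_sub_comm (Q.avg f) c]
        exact abs_sub_le _ _ _
    _ = Q.avgAbs (fun x => f x - c) + |Q.avg f - c| := by
        rw [Q.avg_add hfc (Q.integrableOn_const _), Q.avg_const]; rfl
    _ ≤ _ := by linarith

theorem avgAbs_le_of_subset {Q Q' : Cube n} {f : (Fin n → ℝ) → ℝ} (hf : IntegrableOn f Q'.toSet)
    (h : Q.toSet ⊆ Q'.toSet) (hs : Q'.side ≤ 2 * Q.side) :
    Q.avgAbs f ≤ 2 ^ n * Q'.avgAbs f := by
  have h1 := Q.side_pos
  have h2 := Q'.side_pos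
  change Q.avg (fun x => |f x|) ≤ 2 ^ n * Q'.avg (fun x => |f x|)
  rw [avg_eq, avg_eq, ← mul_assoc]
  refine mul_le_mul ?_ (setIntegral_mono_set hf.abs (ae_of_all _ fun _ => abs_nonneg _)
    h.eventuallyLE) (integral_nonneg fun _ => abs_nonneg _) (by positivity)
  rw [← div_eq_mul_inv, inv_eq_one_div, div_le_div_iff₀ (by positivity) (by positivity), one_mul,
    ← mul_pow]
  gcongr

theorem avgAbs_add_le (Q : Cube n) {f g : (Fin n → ℝ) → ℝ} (hf : IntegrableOn f Q.toSet)
    (hg : IntegrableOn g Q.toSet) :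
    Q.avgAbs (fun x => f x + g x) ≤ Q.avgAbs f + Q.avgAbs g := by
  change _ ≤ Q.avg (fun x => |f x|) + Q.avg (fun x => |g x|)
  rw [← Q.avg_add hf.abs hg.abs]
  exact Q.avg_mono (hf.add hg).abs (hf.abs.add hg.abs) fun x _ => abs_add_le _ _

/-- Passing from a cube to a concentric cube of half the size. -/
theorem avgAbs_le_double (Q : Cube n) {f : (Fin n → ℝ) → ℝ} (hf : IntegrableOn f Q.double.toSet) :
    Q.avgAbs f ≤ Q.double.avgAbs f + 2 ^ n * Q.double.osc f := by
  have hsub : Q.toSet ⊆ Q.double.toSet :=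
    closedBall_subset_closedBall (by simp only [double]; linarith [Q.half_pos])
  set c := Q.double.avg f with hc
  have hi : IntegrableOn (fun x => f x - c) Q.double.toSet :=
    hf.sub (Q.double.integrableOn_const _)
  have h1 := Q.avgAbs_add_le (hi.mono_set hsub) (Q.integrableOn_const c)
  have h2 : Q.avgAbs (fun _ => c) = |c| := Q.avg_const _
  have h3 := avgAbs_le_of_subset hi hsub (by simp [side, double])
  have h4 := Q.double.abs_avg_le f
  simp only [sub_add_cancel] at h1
  change _ ≤ 2 ^ n * Q.double.osc f at h3
  rw [← hc] at h4
  change Q.avgAbs f ≤ _ at h1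
  linarith

/-- The mean of `|f|` over a small cube blows up at most like the inverse side length. -/
theorem avgAbs_mul_side_le {f : (Fin n → ℝ) → ℝ} (c : Fin n → ℝ) {G : ℝ}
    (hf : ∀ Q : Cube n, IntegrableOn f Q.toSet)
    (hosc : ∀ Q : Cube n, Q.center = c → Q.side < 1 → Q.osc f ≤ G)
    (havg : ∀ Q : Cube n, Q.center = c → Q.side = 1 → Q.avgAbs f ≤ G)
    (Q : Cube n) (hQc : Q.center = c) (hQ : Q.side ≤ 1) : Q.avgAbs f * Q.side ≤ 2 ^ (n + 1) * G := by
  have hG : 0 ≤ G := (avgAbs_nonneg _ _).trans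
    (havg ⟨c, 1 / 2, by norm_num⟩ rfl (by norm_num [side]))
  have key (k : ℕ) : ∀ Q : Cube n, Q.center = c → Q.side ≤ 1 → 1 / 2 ≤ 2 ^ k * Q.side →
      Q.avgAbs f * Q.side ≤ 2 ^ (n + 1) * G := by
    have big (Q : Cube n) (hQc : Q.center = c) (hQ : Q.side ≤ 1) (hk : 1 / 2 ≤ Q.side) :
        Q.avgAbs f * Q.side ≤ 2 ^ (n + 1) * G := by
      have h1 : Q.avgAbs f ≤ 2 ^ n * (⟨c, 1 / 2, by norm_num⟩ : Cube n).avgAbs f := by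
        refine avgAbs_le_of_subset (hf _) ?_ ?_
        · simp only [toSet, hQc]
          exact closedBall_subset_closedBall (by simp only [side] at hQ; linarith)
        · simp only [side] at hk ⊢; linarith
      have h2 := havg ⟨c, 1 / 2, by norm_num⟩ rfl (by norm_num [side])
      have h3 : Q.avgAbs f ≤ 2 ^ n * G := h1.trans (by gcongr)
      calc Q.avgAbs f * Q.side ≤ (2 ^ n * G) * 1 := by
            gcongr
        _ ≤ 2 ^ (n + 1) * G := by
            rw [pow_succ]; nlinarith [mul_nonneg (by positivity : (0 : ℝ) ≤ 2 ^ n) hG]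
    induction k with
    | zero => exact fun Q hQc hQ hk => big Q hQc hQ (by simpa using hk)
    | succ k ih =>
      intro Q hQc hQ hk
      by_cases hb : 1 / 2 ≤ Q.side
      · exact big Q hQc hQ hb
      push Not at hb
      have hds : Q.double.side = 2 * Q.side := rfl
      have h1 := ih Q.double hQc (by linarith) (by rw [hds]; rw [pow_succ] at hk; linarith)
      have h2 := hosc Q.double hQc (by linarith)
      have h3 := Q.avgAbs_le_double (hf _)
      rw [hds] at h1
      have hs := Q.side_pos
      have hG2 : 0 ≤ 2 ^ n * G := by positivity
      have h4 : 2 ^ n * Q.double.osc f ≤ 2 ^ n * G := by gcongr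
      rw [pow_succ] at h1 ⊢
      calc Q.avgAbs f * Q.side ≤ (Q.double.avgAbs f + 2 ^ n * G) * Q.side := by
            gcongr; linarith
        _ ≤ _ := by nlinarith
  obtain ⟨k, hk⟩ := pow_unbounded_of_one_lt (1 / 2 / Q.side) (one_lt_two : (1 : ℝ) < 2)
  exact key k Q hQc hQ ((div_lt_iff₀ Q.side_pos).1 hk).le

/-- Covering a cube by its corner subcubes of a given size. -/
theorem exists_subcube_avgAbs_le (Q : Cube n) {f : (Fin n → ℝ) → ℝ} (hf : IntegrableOn f Q.toSet)
    {r : ℝ} (hr : Q.half ≤ 2 * r) (hrQ : r ≤ Q.half) :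
    ∃ Q' : Cube n, Q'.half = r ∧ Q'.toSet ⊆ Q.toSet ∧
      Q.avgAbs f ≤ (2 * r / Q.half) ^ n * Q'.avgAbs f := by
  have hQ := Q.half_pos
  have hr0 : 0 < r := by linarith
  let S (σ : Fin n → Bool) : Cube n :=
    ⟨fun i => Q.center i + if σ i then Q.half - r else r - Q.half, r, hr0⟩
  have hsub (σ) : (S σ).toSet ⊆ Q.toSet := by
    refine closedBall_subset_closedBall' ?_
    have : dist (S σ).center Q.center ≤ Q.half - r := by
      refine (dist_pi_le_iff (by linarith)).2 fun i => ?_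
      simp only [S, Real.dist_eq, add_sub_cancel_left]
      split_ifs <;> rw [abs_le] <;> constructor <;> linarith
    simp only [S] at this ⊢
    linarith
  have hcov : Q.toSet ⊆ ⋃ σ ∈ (Finset.univ : Finset (Fin n → Bool)), (S σ).toSet := by
    intro x hx
    simp only [Finset.mem_univ, Set.iUnion_true, Set.mem_iUnion]
    refine ⟨fun i => decide (Q.center i ≤ x i), ?_⟩
    refine (dist_pi_le_iff hr0.le).2 fun i => ?_
    have hxi := (dist_pi_le_iff hQ.le).1 hx i
    rw [Real.dist_eq, abs_le] at hxi
    simp only [S, Real.dist_eq, decide_eq_true_eq]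
    split_ifs with h <;> rw [abs_le] <;> constructor <;> linarith
  obtain ⟨σ, -, hσ⟩ := Finset.exists_max_image (Finset.univ : Finset (Fin n → Bool))
    (fun σ => ∫ x in (S σ).toSet, |f x|) Finset.univ_nonempty
  refine ⟨S σ, rfl, hsub σ, ?_⟩
  have hint : ∫ x in Q.toSet, |f x| ≤ 2 ^ n * ∫ x in (S σ).toSet, |f x| := by
    have h1 : ∫ x in Q.toSet, |f x| ≤
        ∑ τ : Fin n → Bool, ∫ x in (S τ).toSet, |f x| := by
      have hle : ∀ x ∈ Q.toSet,
          |f x| ≤ ∑ τ : Fin n → Bool, (S τ).toSet.indicator (fun x => |f x|) x := by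
        intro x hx
        obtain ⟨τ, -, hτ⟩ := Set.mem_iUnion₂.1 (hcov hx)
        rw [← Set.indicator_of_mem hτ (fun x => |f x|)]
        exact Finset.single_le_sum (f := fun τ => (S τ).toSet.indicator (fun x => |f x|) x)
          (fun τ _ => Set.indicator_nonneg (fun _ _ => abs_nonneg _) _) (Finset.mem_univ τ)
      have hI (τ) : IntegrableOn ((S τ).toSet.indicator fun x => |f x|) Q.toSet :=
        hf.abs.indicator (S τ).measurableSet_toSet
      calc _ ≤ ∫ x in Q.toSet, ∑ τ : Fin n → Bool, (S τ).toSet.indicator (fun x => |f x|) x :=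
            setIntegral_mono_on hf.abs (integrable_finsetSum _ fun τ _ => hI τ)
              Q.measurableSet_toSet hle
        _ = _ := by
            rw [integral_finsetSum _ fun τ _ => hI τ]
            refine Finset.sum_congr rfl fun τ _ => ?_
            rw [setIntegral_indicator (S τ).measurableSet_toSet, Set.inter_eq_right.2 (hsub τ)]
    refine h1.trans ((Finset.sum_le_card_nsmul _ _ _ hσ).trans_eq ?_)
    simp
  change Q.avg (fun x => |f x|) ≤ _ * (S σ).avg (fun x => |f x|)
  rw [avg_eq, avg_eq]
  calc (Q.side ^ n)⁻¹ * ∫ x in Q.toSet, |f x|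
      ≤ (Q.side ^ n)⁻¹ * (2 ^ n * ∫ x in (S σ).toSet, |f x|) :=
        mul_le_mul_of_nonneg_left hint (by have := Q.side_pos; positivity)
    _ = _ := by
        have : (S σ).side = 2 * r := rfl
        rw [this, side, ← inv_pow, ← inv_pow, ← mul_assoc, ← mul_assoc, ← mul_pow, ← mul_pow]
        congr 2
        field_simp

/-- The mean over a large cube is controlled by the mean over some unit subcube. -/
theorem exists_unit_subcube_avgAbs_le (Q : Cube n) {f : (Fin n → ℝ) → ℝ}
    (hf : IntegrableOn f Q.toSet) (hQ : 1 ≤ Q.side) :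
    ∃ Q' : Cube n, Q'.side = 1 ∧ Q'.toSet ⊆ Q.toSet ∧ Q.avgAbs f ≤ 2 ^ n * Q'.avgAbs f := by
  have key (k : ℕ) : ∀ Q : Cube n, IntegrableOn f Q.toSet → 1 ≤ Q.side → Q.side ≤ 2 ^ (k + 1) →
      ∃ Q' : Cube n, Q'.side = 1 ∧ Q'.toSet ⊆ Q.toSet ∧ Q.avgAbs f ≤ 2 ^ n * Q'.avgAbs f := by
    have small (Q : Cube n) (hf : IntegrableOn f Q.toSet) (hQ : 1 ≤ Q.side) (hQ2 : Q.side ≤ 2) :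
        ∃ Q' : Cube n, Q'.side = 1 ∧ Q'.toSet ⊆ Q.toSet ∧ Q.avgAbs f ≤ 2 ^ n * Q'.avgAbs f := by
      simp only [side] at hQ hQ2
      obtain ⟨Q', h1, h2, h3⟩ := Q.exists_subcube_avgAbs_le hf (r := 1 / 2)
        (by linarith) (by linarith)
      refine ⟨Q', by rw [side, h1]; norm_num, h2, h3.trans ?_⟩
      have := Q.half_pos
      have := Q'.avgAbs_nonneg f
      gcongr
      rw [div_le_iff₀ (by assumption)]
      linarith
    induction k with
    | zero => exact fun Q hf hQ hk => small Q hf hQ (by simpa using hk)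
    | succ k ih =>
      intro Q hf hQ hk
      rcases le_total Q.side 2 with h | h
      · exact small Q hf hQ h
      have hp := Q.half_pos
      obtain ⟨Q', h1, h2, h3⟩ := Q.exists_subcube_avgAbs_le hf (r := Q.half / 2)
        (by linarith) (by linarith)
      have h4 : 2 * (Q.half / 2) / Q.half = 1 := by field_simp
      rw [h4, one_pow, one_mul] at h3
      have h5 : Q'.side = Q.side / 2 := by rw [side, side, h1]; ring
      obtain ⟨Q'', g1, g2, g3⟩ := ih Q' (hf.mono_set h2) (by linarith)
        (by rw [pow_succ] at hk; linarith)
      exact ⟨Q'', g1, g2.trans h2, h3.trans g3⟩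
  obtain ⟨k, hk⟩ := pow_unbounded_of_one_lt Q.side (one_lt_two : (1 : ℝ) < 2)
  exact key k Q hf hQ (hk.le.trans (pow_le_pow_right₀ one_le_two k.le_succ))

theorem toSet_nonempty (Q : Cube n) : Q.toSet.Nonempty :=
  nonempty_closedBall.2 Q.half_pos.le

theorem distToOrigin_le (Q : Cube n) {x : Fin n → ℝ} (hx : x ∈ Q.toSet) :
    Q.distToOrigin ≤ ‖x‖ := by
  simpa [distToOrigin] using infDist_le_dist_of_mem (x := (0 : Fin n → ℝ)) hx

theorem le_distToOrigin (Q : Cube n) {d : ℝ} (h : ∀ x ∈ Q.toSet, d ≤ ‖x‖) :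
    d ≤ Q.distToOrigin :=
  (le_infDist Q.toSet_nonempty).2 fun {y} hy => by simpa [dist_eq_norm] using h y hy

theorem norm_sub_le_side (Q : Cube n) {x y : Fin n → ℝ} (hx : x ∈ Q.toSet) (hy : y ∈ Q.toSet) :
    ‖x - y‖ ≤ Q.side := by
  rw [← dist_eq_norm, side]
  linarith [dist_triangle_right x y Q.center, mem_closedBall.1 hx, mem_closedBall.1 hy]

theorem center_mem (Q : Cube n) : Q.center ∈ Q.toSet := mem_closedBall_self Q.half_pos.le

theorem norm_le_distToOrigin_add_side (Q : Cube n) {x : Fin n → ℝ} (hx : x ∈ Q.toSet) :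
    ‖x‖ - Q.side ≤ Q.distToOrigin :=
  Q.le_distToOrigin fun y hy => by
    linarith [norm_sub_norm_le x y, Q.norm_sub_le_side hx hy]

/-- Multiplication by a bounded Lipschitz function. -/
theorem osc_mul_le (Q : Cube n) {f φ : (Fin n → ℝ) → ℝ} (hf : IntegrableOn f Q.toSet)
    (hφ : LipschitzWith 1 φ) (hφ1 : ∀ x, |φ x| ≤ 1) :
    Q.osc (fun x => φ x * f x) ≤ 2 * (Q.avgAbs f * Q.side + Q.osc f) := by
  have hi : IntegrableOn (fun x => φ x * f x) Q.toSet :=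
    Integrable.bdd_mul hf hφ.continuous.aestronglyMeasurable (ae_of_all _ hφ1)
  refine (Q.osc_le_two_mul hi (φ Q.center * Q.avg f)).trans ?_
  refine mul_le_mul_of_nonneg_left ?_ zero_le_two
  have ho : IntegrableOn (fun x => |f x - Q.avg f|) Q.toSet :=
    (hf.sub (Q.integrableOn_const _)).abs
  have hs : IntegrableOn (fun x => Q.side * |f x|) Q.toSet := hf.abs.const_mul _
  calc Q.avgAbs (fun x => φ x * f x - φ Q.center * Q.avg f)
      ≤ Q.avg (fun x => Q.side * |f x| + |f x - Q.avg f|) := by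
        refine Q.avg_mono (hi.sub (Q.integrableOn_const _)).abs (hs.add ho) fun x hx => ?_
        have h1 : |φ x - φ Q.center| ≤ Q.side := by
          have := hφ.dist_le_mul x Q.center
          rw [Real.dist_eq, NNReal.coe_one, one_mul, dist_eq_norm] at this
          exact this.trans (Q.norm_sub_le_side hx Q.center_mem)
        calc |φ x * f x - φ Q.center * Q.avg f|
            = |(φ x - φ Q.center) * f x + φ Q.center * (f x - Q.avg f)| := by ring_nf
          _ ≤ |φ x - φ Q.center| * |f x| + |φ Q.center| * |f x - Q.avg f| := by
              rw [← abs_mul, ← abs_mul]; exact abs_add_le _ _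
          _ ≤ Q.side * |f x| + 1 * |f x - Q.avg f| := by gcongr; exact hφ1 _
          _ = _ := by rw [one_mul]
    _ = _ := by
        rw [Q.avg_add hs ho, Q.avg_const_mul, mul_comm]; rfl

theorem osc_sub_le (Q : Cube n) {f g : (Fin n → ℝ) → ℝ} (hf : IntegrableOn f Q.toSet)
    (hg : IntegrableOn g Q.toSet) : Q.osc (f - g) ≤ Q.osc f + Q.osc g := by
  have hf' : IntegrableOn (fun x => |f x - Q.avg f|) Q.toSet :=
    (hf.sub (Q.integrableOn_const _)).abs
  have hg' : IntegrableOn (fun x => |g x - Q.avg g|) Q.toSet :=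
    (hg.sub (Q.integrableOn_const _)).abs
  change _ ≤ Q.avg (fun x => |f x - Q.avg f|) + Q.avg (fun x => |g x - Q.avg g|)
  rw [← Q.avg_add hf' hg']
  refine Q.avg_mono ((hf.sub hg).sub (Q.integrableOn_const _)).abs (hf'.add hg') fun x _ => ?_
  have : Q.avg (f - g) = Q.avg f - Q.avg g := Q.avg_sub hf hg
  rw [this, Pi.sub_apply, sub_sub_sub_comm]
  exact abs_sub _ _

theorem avgAbs_sub_le (Q : Cube n) {f g : (Fin n → ℝ) → ℝ} (hf : IntegrableOn f Q.toSet)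
    (hg : IntegrableOn g Q.toSet) : Q.avgAbs (f - g) ≤ Q.avgAbs f + Q.avgAbs g := by
  change _ ≤ Q.avg (fun x => |f x|) + Q.avg (fun x => |g x|)
  rw [← Q.avg_add hf.abs hg.abs]
  exact Q.avg_mono (hf.sub hg).abs (hf.abs.add hg.abs) fun x _ => abs_sub _ _

end Cube

theorem memBmo_univ_one_iff {f : (Fin n → ℝ) → ℝ} :
    MemBmo Set.univ 1 f ↔ (∀ Q : Cube n, IntegrableOn f Q.toSet) ∧
      ∃ M, (∀ Q : Cube n, Q.side < 1 → Q.osc f ≤ M) ∧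
        ∀ Q : Cube n, 1 ≤ Q.side → Q.avgAbs f ≤ M := by
  constructor
  · rintro ⟨h, ⟨A, hA⟩, ⟨B, hB⟩⟩
    exact ⟨fun Q => h Q (Set.subset_univ _), max A B,
      fun Q hQ => (hA ⟨Q, Set.subset_univ _, hQ, rfl⟩).trans (le_max_left _ _),
      fun Q hQ => (hB ⟨Q, Set.subset_univ _, hQ, rfl⟩).trans (le_max_right _ _)⟩
  · rintro ⟨h, M, hA, hB⟩
    refine ⟨fun Q _ => h Q, ⟨M, ?_⟩, ⟨M, ?_⟩⟩
    · rintro _ ⟨Q, -, hQ, rfl⟩; exact hA Q hQ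
    · rintro _ ⟨Q, -, hQ, rfl⟩; exact hB Q hQ

theorem MemBmo.sub {f g : (Fin n → ℝ) → ℝ} (hf : MemBmo Set.univ 1 f)
    (hg : MemBmo Set.univ 1 g) : MemBmo Set.univ 1 (f - g) := by
  rw [memBmo_univ_one_iff] at *
  obtain ⟨hfi, M, h1, h2⟩ := hf
  obtain ⟨hgi, N, h3, h4⟩ := hg
  exact ⟨fun Q => (hfi Q).sub (hgi Q), M + N,
    fun Q hQ => (Q.osc_sub_le (hfi Q) (hgi Q)).trans (add_le_add (h1 Q hQ) (h3 Q hQ)),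
    fun Q hQ => (Q.avgAbs_sub_le (hfi Q) (hgi Q)).trans (add_le_add (h2 Q hQ) (h4 Q hQ))⟩

/-- Multiplication by a bounded Lipschitz function preserves bmo. -/
theorem MemBmo.lipschitz_mul {f φ : (Fin n → ℝ) → ℝ} (hf : MemBmo Set.univ 1 f)
    (hφ : LipschitzWith 1 φ) (hφ1 : ∀ x, |φ x| ≤ 1) :
    MemBmo Set.univ 1 (fun x => φ x * f x) := by
  rw [memBmo_univ_one_iff] at *
  obtain ⟨hfi, M, h1, h2⟩ := hf
  have hi (Q : Cube n) : IntegrableOn (fun x => φ x * f x) Q.toSet :=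
    Integrable.bdd_mul (hfi Q) hφ.continuous.aestronglyMeasurable (ae_of_all _ hφ1)
  refine ⟨hi, max (2 * (2 ^ (n + 1) * M + M)) M,
    fun Q hQ => (Q.osc_mul_le (hfi Q) hφ hφ1).trans ((?_ : _ ≤ _).trans (le_max_left _ _)),
    fun Q hQ => (Q.avgAbs_mono (hi Q) (hfi Q) fun x _ => ?_).trans
      ((h2 Q hQ).trans (le_max_right _ _))⟩
  · have := Cube.avgAbs_mul_side_le Q.center hfi (fun Q _ => h1 Q)
      (fun Q _ h => h2 Q h.ge) Q rfl hQ.le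
    linarith [h1 Q hQ]
  · rw [abs_mul]
    exact mul_le_of_le_one_left (abs_nonneg _) (hφ1 x)

/-- The condition that oscillations over small cubes and means over unit cubes are small far out. -/
def SmallFarOut (f : (Fin n → ℝ) → ℝ) : Prop :=
  ∀ ε > 0, ∀ᶠ β : ℝ in atTop, ∀ Q : Cube n, β < Q.distToOrigin →
    (Q.side < 1 → Q.osc f ≤ ε) ∧ (Q.side = 1 → Q.avgAbs f ≤ ε)

theorem SmallFarOut.avgAbs_mul_side_le {f : (Fin n → ℝ) → ℝ} (h : SmallFarOut f)
    (hf : ∀ Q : Cube n, IntegrableOn f Q.toSet) {ε : ℝ} (hε : 0 < ε) :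
    ∀ᶠ β : ℝ in atTop, ∀ Q : Cube n, β < Q.distToOrigin → Q.side ≤ 1 →
      Q.avgAbs f * Q.side ≤ ε := by
  have hC : (0 : ℝ) < 2 ^ (n + 1) := by positivity
  filter_upwards [(tendsto_atTop_add_const_right _ (-1) tendsto_id).eventually
    (h (ε / 2 ^ (n + 1)) (by positivity))] with β hβ Q hQ hs
  have far (Q' : Cube n) (hc : Q'.center = Q.center) (hs' : Q'.side ≤ 1) :
      β + -1 < Q'.distToOrigin := by
    have := Q'.norm_le_distToOrigin_add_side Q'.center_mem
    have h2 := Q.distToOrigin_le Q.center_mem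
    rw [hc] at this
    linarith
  have := Cube.avgAbs_mul_side_le Q.center hf
    (fun Q' hc hs' => (hβ Q' (far Q' hc hs'.le)).1 hs')
    (fun Q' hc hs' => (hβ Q' (far Q' hc hs'.le)).2 hs') Q rfl hs
  rwa [mul_div_cancel₀ _ hC.ne'] at this

theorem vanishAtInfinity_iff_smallFarOut {f : (Fin n → ℝ) → ℝ} (hf : MemBmo Set.univ 1 f) :
    VanishAtInfinity Set.univ 1 f ↔ SmallFarOut f := by
  obtain ⟨hfi, M, h1, h2⟩ := memBmo_univ_one_iff.1 hf
  unfold VanishAtInfinity bmoNorm omegaOn bigAvgSup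
  rw [tendsto_sSup_add_sSup_iff]
  · constructor
    · intro h ε hε
      filter_upwards [h ε hε] with β hβ Q hQ
      have hsub : Q.toSet ⊆ Set.univ \ closedBall 0 β := fun x hx =>
        ⟨trivial, fun hx' => by
          linarith [Q.distToOrigin_le hx, mem_closedBall_zero_iff.1 hx']⟩
      exact ⟨fun hs => hβ.1 _ ⟨Q, hsub, hs, rfl⟩, fun hs => hβ.2 _ ⟨Q, hsub, hs.ge, rfl⟩⟩
    · intro h ε hε
      have hC : (1 : ℝ) ≤ 2 ^ n := one_le_pow₀ one_le_two
      filter_upwards [(tendsto_atTop_add_const_right _ (-1) tendsto_id).eventually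
        (h (ε / 2 ^ n) (by positivity))] with β hβ
      have far (Q : Cube n) (hQ : Q.toSet ⊆ Set.univ \ closedBall 0 β) :
          β + -1 < Q.distToOrigin := by
        have : β ≤ Q.distToOrigin := Q.le_distToOrigin fun x hx => by
          have := (hQ hx).2
          rw [mem_closedBall_zero_iff, not_le] at this
          exact this.le
        linarith
      constructor
      · rintro _ ⟨Q, hQ, hs, rfl⟩
        exact ((hβ Q (far Q hQ)).1 hs).trans (div_le_self hε.le hC)
      · rintro _ ⟨Q, hQ, hs, rfl⟩
        obtain ⟨Q', g1, g2, g3⟩ := Q.exists_unit_subcube_avgAbs_le (hfi Q) hs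
        refine g3.trans ?_
        have := (hβ Q' (far Q' (g2.trans hQ))).2 g1
        rw [le_div_iff₀ (by positivity)] at this
        linarith
  · rintro i _ ⟨Q, -, -, rfl⟩; exact Q.osc_nonneg f
  · rintro i _ ⟨Q, -, -, rfl⟩; exact Q.avgAbs_nonneg f
  · exact fun i => ⟨M, by rintro _ ⟨Q, -, h, rfl⟩; exact h1 Q h⟩
  · exact fun i => ⟨M, by rintro _ ⟨Q, -, h, rfl⟩; exact h2 Q h⟩

theorem tendsto_unit_iff_smallFarOut {f : (Fin n → ℝ) → ℝ} (hf : MemBmo Set.univ 1 f) :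
    Tendsto (fun β =>
          sSup {r | ∃ Q : Cube n, β < Q.distToOrigin ∧ Q.side < 1 ∧ r = Q.osc f} +
          sSup {r | ∃ Q : Cube n, β < Q.distToOrigin ∧ Q.side = 1 ∧ r = Q.avgAbs f})
        atTop (nhds 0) ↔ SmallFarOut f := by
  obtain ⟨hfi, M, h1, h2⟩ := memBmo_univ_one_iff.1 hf
  rw [tendsto_sSup_add_sSup_iff]
  · refine forall₂_congr fun ε hε => eventually_congr (Eventually.of_forall fun β => ?_)
    constructor
    · exact fun h Q hQ =>
        ⟨fun hs => h.1 _ ⟨Q, hQ, hs, rfl⟩, fun hs => h.2 _ ⟨Q, hQ, hs, rfl⟩⟩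
    · intro h
      constructor
      · rintro _ ⟨Q, hQ, hs, rfl⟩; exact (h Q hQ).1 hs
      · rintro _ ⟨Q, hQ, hs, rfl⟩; exact (h Q hQ).2 hs
  · rintro i _ ⟨Q, -, -, rfl⟩; exact Q.osc_nonneg f
  · rintro i _ ⟨Q, -, -, rfl⟩; exact Q.avgAbs_nonneg f
  · exact fun i => ⟨M, by rintro _ ⟨Q, -, h, rfl⟩; exact h1 Q h⟩
  · exact fun i => ⟨M, by rintro _ ⟨Q, -, h, rfl⟩; exact h2 Q h.ge⟩

theorem tendsto_mul_side_iff_smallFarOut {f : (Fin n → ℝ) → ℝ} (hf : MemBmo Set.univ 1 f) :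
    Tendsto (fun β =>
          sSup {r | ∃ Q : Cube n, β < Q.distToOrigin ∧ Q.side < 1 ∧ r = Q.osc f} +
          sSup {r | ∃ Q : Cube n, β < Q.distToOrigin ∧ Q.side ≤ 1 ∧ r = Q.avgAbs f * Q.side})
        atTop (nhds 0) ↔ SmallFarOut f := by
  obtain ⟨hfi, M, h1, h2⟩ := memBmo_univ_one_iff.1 hf
  rw [tendsto_sSup_add_sSup_iff]
  · constructor
    · intro h ε hε
      filter_upwards [h ε hε] with β hβ Q hQ
      refine ⟨fun hs => hβ.1 _ ⟨Q, hQ, hs, rfl⟩, fun hs => hβ.2 _ ⟨Q, hQ, hs.le, ?_⟩⟩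
      rw [hs, mul_one]
    · intro h ε hε
      filter_upwards [h ε hε, h.avgAbs_mul_side_le hfi hε] with β hβ hβ'
      constructor
      · rintro _ ⟨Q, hQ, hs, rfl⟩; exact (hβ Q hQ).1 hs
      · rintro _ ⟨Q, hQ, hs, rfl⟩; exact hβ' Q hQ hs
  · rintro i _ ⟨Q, -, -, rfl⟩; exact Q.osc_nonneg f
  · rintro i _ ⟨Q, -, -, rfl⟩; exact mul_nonneg (Q.avgAbs_nonneg f) Q.side_pos.le
  · exact fun i => ⟨M, by rintro _ ⟨Q, -, h, rfl⟩; exact h1 Q h⟩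
  · refine fun i => ⟨2 ^ (n + 1) * M, ?_⟩
    rintro _ ⟨Q, -, h, rfl⟩
    exact Cube.avgAbs_mul_side_le Q.center hfi (fun Q _ => h1 Q) (fun Q _ h => h2 Q h.ge) Q rfl h

theorem tendsto_bmoNorm_univ_iff {ι : Type*} {l : Filter ι} {g : ι → (Fin n → ℝ) → ℝ}
    (hg : ∀ i, MemBmo Set.univ 1 (g i)) :
    Tendsto (fun i => bmoNorm Set.univ 1 (g i)) l (nhds 0) ↔
      ∀ ε > 0, ∀ᶠ i in l, (∀ Q : Cube n, Q.side < 1 → Q.osc (g i) ≤ ε) ∧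
        ∀ Q : Cube n, 1 ≤ Q.side → Q.avgAbs (g i) ≤ ε := by
  unfold bmoNorm omegaOn bigAvgSup
  rw [tendsto_sSup_add_sSup_iff]
  · refine forall₂_congr fun ε hε => eventually_congr (Eventually.of_forall fun i => ?_)
    constructor
    · exact fun h => ⟨fun Q hQ => h.1 _ ⟨Q, Set.subset_univ _, hQ, rfl⟩,
        fun Q hQ => h.2 _ ⟨Q, Set.subset_univ _, hQ, rfl⟩⟩
    · intro h
      constructor
      · rintro _ ⟨Q, -, hs, rfl⟩; exact h.1 Q hs
      · rintro _ ⟨Q, -, hs, rfl⟩; exact h.2 Q hs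
  · rintro i _ ⟨Q, -, -, rfl⟩; exact Q.osc_nonneg _
  · rintro i _ ⟨Q, -, -, rfl⟩; exact Q.avgAbs_nonneg _
  · exact fun i => (hg i).2.1
  · exact fun i => (hg i).2.2

/-- A Lipschitz function equal to `0` on the ball of radius `R` and to `1` outside the ball of
radius `R + 1`. -/
def outerCutoff (R : ℝ) (x : Fin n → ℝ) : ℝ := min 1 (max 0 (‖x‖ - R))

theorem outerCutoff_mem_Icc (R : ℝ) (x : Fin n → ℝ) : outerCutoff R x ∈ Set.Icc (0 : ℝ) 1 :=
  ⟨le_min zero_le_one (le_max_left _ _), min_le_left _ _⟩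

theorem lipschitzWith_outerCutoff (R : ℝ) :
    LipschitzWith 1 (outerCutoff R : (Fin n → ℝ) → ℝ) := by
  have h : LipschitzWith 1 fun x : Fin n → ℝ => ‖x‖ - R := by
    refine LipschitzWith.of_dist_le_mul fun x y => ?_
    rw [Real.dist_eq, sub_sub_sub_cancel_right, NNReal.coe_one, one_mul, dist_eq_norm]
    exact abs_norm_sub_norm_le x y
  exact (h.const_max 0).const_min 1

theorem outerCutoff_eq_zero {R : ℝ} {x : Fin n → ℝ} (h : ‖x‖ ≤ R) : outerCutoff R x = 0 := by
  rw [outerCutoff, max_eq_left (by linarith), min_eq_right zero_le_one]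

theorem outerCutoff_eq_one {R : ℝ} {x : Fin n → ℝ} (h : R + 1 ≤ ‖x‖) : outerCutoff R x = 1 :=
  min_eq_left (le_max_of_le_right (by linarith))

theorem SmallFarOut.exists_tendsto {f : (Fin n → ℝ) → ℝ} (hf : MemBmo Set.univ 1 f)
    (h : SmallFarOut f) :
    ∃ F : ℕ → (Fin n → ℝ) → ℝ, (∀ k, MemBmo Set.univ 1 (F k) ∧ HasCompactSupport (F k)) ∧
      Tendsto (fun k => bmoNorm Set.univ 1 (f - F k)) atTop (nhds 0) := by
  have hfi := (memBmo_univ_one_iff.1 hf).1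
  let g (k : ℕ) : (Fin n → ℝ) → ℝ := fun x => outerCutoff k x * f x
  have habs (k : ℕ) (x : Fin n → ℝ) : |outerCutoff k x| ≤ 1 := by
    rw [abs_of_nonneg (outerCutoff_mem_Icc _ _).1]; exact (outerCutoff_mem_Icc _ _).2
  have hg (k : ℕ) : MemBmo Set.univ 1 (g k) :=
    hf.lipschitz_mul (lipschitzWith_outerCutoff _) (habs k)
  have hgi k := (memBmo_univ_one_iff.1 (hg k)).1
  refine ⟨fun k => f - g k, fun k => ⟨hf.sub (hg k), ?_⟩, ?_⟩
  · refine HasCompactSupport.intro (isCompact_closedBall (0 : Fin n → ℝ) (k + 1)) fun x hx => ?_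
    rw [mem_closedBall_zero_iff, not_le] at hx
    simp [g, outerCutoff_eq_one hx.le]
  simp only [sub_sub_cancel]
  rw [tendsto_bmoNorm_univ_iff hg]
  intro ε hε
  have hC : (1 : ℝ) ≤ 2 ^ n := one_le_pow₀ one_le_two
  have hlim : Tendsto (fun k : ℕ => (k : ℝ) + -2) atTop atTop :=
    tendsto_atTop_add_const_right _ _ tendsto_natCast_atTop_atTop
  filter_upwards [hlim.eventually (h (ε / 2 ^ n) (by positivity)),
    hlim.eventually (h (ε / 4) (by positivity)),
    hlim.eventually (h.avgAbs_mul_side_le hfi (ε := ε / 4) (by positivity))] with k h1 h2 h3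
  have alt (Q : Cube n) (hs : Q.side ≤ 1) :
      (∀ x ∈ Q.toSet, g k x = 0) ∨ (k : ℝ) + -2 < Q.distToOrigin := by
    by_cases hx : ∀ x ∈ Q.toSet, ‖x‖ ≤ k
    · left
      intro x hxQ
      simp [g, outerCutoff_eq_zero (hx x hxQ)]
    · push Not at hx
      obtain ⟨x, hxQ, hx⟩ := hx
      right
      linarith [Q.norm_le_distToOrigin_add_side hxQ]
  constructor
  · intro Q hs
    rcases alt Q hs.le with h0 | hfar
    · rw [Q.osc_congr h0, Q.osc_zero]; exact hε.le
    · have := Q.osc_mul_le (hfi Q) (lipschitzWith_outerCutoff k) (habs k)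
      change Q.osc (g k) ≤ _ at this
      linarith [(h2 Q hfar).1 hs, h3 Q hfar hs.le]
  · intro Q hs
    obtain ⟨Q', g1, g2, g3⟩ := Q.exists_unit_subcube_avgAbs_le (hgi k Q) hs
    refine g3.trans ?_
    rcases alt Q' g1.le with h0 | hfar
    · rw [Q'.avgAbs_congr h0, Q'.avgAbs_zero, mul_zero]; exact hε.le
    · have h4 := (h1 Q' hfar).2 g1
      have h5 : Q'.avgAbs (g k) ≤ Q'.avgAbs f :=
        Q'.avgAbs_mono (hgi k Q') (hfi Q') fun x _ => by
          rw [abs_mul]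
          exact mul_le_of_le_one_left (abs_nonneg _) (habs k x)
      rw [le_div_iff₀ (by positivity)] at h4
      nlinarith

theorem smallFarOut_of_tendsto {f : (Fin n → ℝ) → ℝ} (hf : MemBmo Set.univ 1 f)
    {F : ℕ → (Fin n → ℝ) → ℝ} (hF : ∀ k, MemBmo Set.univ 1 (F k) ∧ HasCompactSupport (F k))
    (h : Tendsto (fun k => bmoNorm Set.univ 1 (f - F k)) atTop (nhds 0)) : SmallFarOut f := by
  rw [tendsto_bmoNorm_univ_iff fun k => hf.sub (hF k).1] at h
  intro ε hε
  obtain ⟨k, hk1, hk2⟩ := (h ε hε).exists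
  obtain ⟨R, hR⟩ := (hF k).2.isCompact.isBounded.subset_closedBall (0 : Fin n → ℝ)
  filter_upwards [eventually_ge_atTop R] with β hβ Q hQ
  have heq : ∀ x ∈ Q.toSet, f x = (f - F k) x := fun x hx => by
    have : F k x = 0 := image_eq_zero_of_notMem_tsupport fun hx' => by
      linarith [mem_closedBall_zero_iff.1 (hR hx'), Q.distToOrigin_le hx]
    simp [this]
  rw [Q.osc_congr heq, Q.avgAbs_congr heq]
  exact ⟨hk1 Q, fun hs => hk2 Q hs.ge⟩

/-- Characterization of vanishing at infinity in bmo(ℝⁿ): for f ∈ bmo(ℝⁿ), approximability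
by compactly supported bmo functions, vanishing at infinity of the bmo norm, the vanishing
of γ(f,β), and condition (iv) are all equivalent. -/
theorem stmt7 {n : ℕ} (hn : 0 < n) (f : (Fin n → ℝ) → ℝ)
    (hf : MemBmo (Set.univ : Set (Fin n → ℝ)) 1 f) :
    ((∃ F : ℕ → (Fin n → ℝ) → ℝ,
        (∀ k, MemBmo (Set.univ : Set (Fin n → ℝ)) 1 (F k) ∧ HasCompactSupport (F k)) ∧
        Tendsto (fun k => bmoNorm Set.univ 1 (f - F k)) atTop (nhds 0)) ↔
      VanishAtInfinity (Set.univ : Set (Fin n → ℝ)) 1 f) ∧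
    (VanishAtInfinity (Set.univ : Set (Fin n → ℝ)) 1 f ↔
      Tendsto (fun β =>
          sSup {r | ∃ Q : Cube n, β < Q.distToOrigin ∧ Q.side < 1 ∧ r = Q.osc f} +
          sSup {r | ∃ Q : Cube n, β < Q.distToOrigin ∧ Q.side = 1 ∧ r = Q.avgAbs f})
        atTop (nhds 0)) ∧
    (Tendsto (fun β =>
          sSup {r | ∃ Q : Cube n, β < Q.distToOrigin ∧ Q.side < 1 ∧ r = Q.osc f} +
          sSup {r | ∃ Q : Cube n, β < Q.distToOrigin ∧ Q.side = 1 ∧ r = Q.avgAbs f})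
        atTop (nhds 0) ↔
      Tendsto (fun β =>
          sSup {r | ∃ Q : Cube n, β < Q.distToOrigin ∧ Q.side < 1 ∧ r = Q.osc f} +
          sSup {r | ∃ Q : Cube n, β < Q.distToOrigin ∧ Q.side ≤ 1 ∧ r = Q.avgAbs f * Q.side})
        atTop (nhds 0)) := by
  rw [vanishAtInfinity_iff_smallFarOut hf, tendsto_unit_iff_smallFarOut hf,
    tendsto_mul_side_iff_smallFarOut hf]
  exact ⟨⟨fun ⟨_, hF, h⟩ => smallFarOut_of_tendsto hf hF h, fun h => h.exists_tendsto hf⟩,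
    Iff.rfl, Iff.rfl⟩
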